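/- Let 1 ≤ d ≤ 3, T > 0, ε > 0, γ > 1, s ≥ −1, and let (ρ, u, v) be smooth on [0,T] × 𝕋^d with ρ > 0, satisfying pointwise the augmented Euler–Korteweg system: ∂_t ρ + div(ρu) = 0; ∂_t(ρu) + div(ρ u⊗u) + ∇p(ρ) = ε²[div(μ(ρ)∇v) + ½∇(λ(ρ) div v)]; ∂_t(ρv) + div(ρ v⊗u) + div(μ(ρ) ᵗ∇u) + ½∇(λ(ρ) div u) = 0, with v = ∇(μ∘ρ)/ρ. Then the energy E(t) = ∫_{𝕋^d} ( ½ ρ|u|² + ½ ε² K(ρ)|∇ρ|² + H(ρ) ) dx is constant on [0,T]. -/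

import Mathlib

open MeasureTheory

noncomputable section

abbrev Vec (d : ℕ) := Fin d → ℝ

/-- Spatial partial derivative in direction `i`. -/
noncomputable def pd {d : ℕ} (i : Fin d) (f : Vec d → ℝ) (x : Vec d) : ℝ :=
  fderiv ℝ f x (Pi.single i 1)

/-- Periodicity with period `1` in each space direction: this models fields on the torus
`𝕋^d = (ℝ/ℤ)^d`. -/
def SpacePeriodic {d : ℕ} {α : Type*} (f : ℝ → Vec d → α) : Prop :=
  ∀ (t : ℝ) (x : Vec d) (k : Fin d → ℤ), f t (fun i => x i + (k i : ℝ)) = f t x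

/-- Fundamental domain `[0,1]^d` of the torus. -/
def Box (d : ℕ) : Set (Vec d) := Set.Icc 0 1

theorem energy_flux_algebra {d : ℕ} {r rt Q M L ε : ℝ} {u v ut vt q b c m : Fin d → ℝ}
    {Du Dv B C : Fin d → Fin d → ℝ} (hsymm : ∀ i j, Dv i j = Dv j i)
    (hmass : rt + ∑ j, m j = 0)
    (hmom : ∀ i, rt * u i + r * ut i + ∑ j, (m j * u i + r * u j * Du j i) + r * q i
      = ε ^ 2 * (∑ j, B i j + 1 / 2 * b i))
    (hdrift : ∀ i, rt * v i + r * vt i + ∑ j, (m j * v i + r * u j * Dv j i)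
      + ∑ j, C i j + 1 / 2 * c i = 0) :
    rt * (1 / 2 * ∑ i, u i ^ 2 + 1 / 2 * ε ^ 2 * ∑ i, v i ^ 2 + Q)
        + r * (∑ i, u i * ut i + ε ^ 2 * ∑ i, v i * vt i)
      + ∑ j, (m j * (1 / 2 * ∑ i, u i ^ 2 + 1 / 2 * ε ^ 2 * ∑ i, v i ^ 2 + Q)
          + r * u j * (∑ i, u i * Du j i + ε ^ 2 * ∑ i, v i * Dv j i + q j)
          + ε ^ 2 * (∑ i, (Dv j i * (M * Du i j) + v i * C i j)
            - ∑ i, (Du j i * (M * Dv j i) + u i * B i j)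
            + 1 / 2 * (Dv j j * (L * ∑ k, Du k k) + v j * c j)
            - 1 / 2 * (Du j j * (L * ∑ k, Dv k k) + u j * b j))) = 0 := by
  have hu : ∑ i, u i * (r * ut i) = ∑ i, u i * (ε ^ 2 * (∑ j, B i j + 1 / 2 * b i)
      - ∑ j, r * u j * Du j i - r * q i) := by
    refine Finset.sum_congr rfl fun i _ => ?_
    have h := hmom i
    rw [Finset.sum_add_distrib, ← Finset.sum_mul] at h
    linear_combination u i * h - u i ^ 2 * hmass
  have hv : ∑ i, v i * (r * vt i) = ∑ i, v i * (-∑ j, r * u j * Dv j i - ∑ j, C i j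
      - 1 / 2 * c i) := by
    refine Finset.sum_congr rfl fun i _ => ?_
    have h := hdrift i
    rw [Finset.sum_add_distrib, ← Finset.sum_mul] at h
    linear_combination v i * h - v i ^ 2 * hmass
  have hcross : ∑ j, ∑ i, Dv j i * (M * Du i j) = ∑ j, ∑ i, Du j i * (M * Dv j i) := by
    rw [Finset.sum_comm]
    refine Finset.sum_congr rfl fun i _ => Finset.sum_congr rfl fun j _ => ?_
    rw [hsymm j i]
    ring
  have swap : ∀ (a w : Fin d → ℝ) (X : Fin d → Fin d → ℝ),
      ∑ i, w i * ∑ j, a j * X j i = ∑ j, a j * ∑ i, w i * X j i := by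
    intro a w X
    simp only [Finset.mul_sum]
    rw [Finset.sum_comm]
    exact Finset.sum_congr rfl fun i _ => Finset.sum_congr rfl fun j _ => by ring
  have swap' : ∀ (w : Fin d → ℝ) (X : Fin d → Fin d → ℝ),
      ∑ i, w i * ∑ j, X i j = ∑ j, ∑ i, w i * X i j := by
    intro w X
    simp only [Finset.mul_sum]
    rw [Finset.sum_comm]
  have hu1 := swap (fun j => r * u j) u Du
  have hv1 := swap (fun j => r * u j) v Dv
  have hu2 := swap' u B
  have hv2 := swap' v C
  have hu' : r * ∑ i, u i * ut i = ε ^ 2 * (∑ i, u i * ∑ j, B i j) +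
      ε ^ 2 * (1 / 2) * ∑ i, u i * b i
      - ∑ i, u i * ∑ j, r * u j * Du j i - ∑ i, r * u i * q i := by
    rw [Finset.mul_sum, Finset.mul_sum, Finset.mul_sum, ← Finset.sum_add_distrib,
      ← Finset.sum_sub_distrib, ← Finset.sum_sub_distrib]
    calc _ = ∑ i, u i * (r * ut i) := Finset.sum_congr rfl fun i _ => by ring
      _ = _ := by rw [hu]; exact Finset.sum_congr rfl fun i _ => by ring
  have hv' : r * ∑ i, v i * vt i = - (∑ i, v i * ∑ j, r * u j * Dv j i)
      - ∑ i, v i * ∑ j, C i j - 1 / 2 * ∑ i, v i * c i := by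
    rw [Finset.mul_sum, Finset.mul_sum, ← Finset.sum_neg_distrib,
      ← Finset.sum_sub_distrib, ← Finset.sum_sub_distrib]
    calc _ = ∑ i, v i * (r * vt i) := Finset.sum_congr rfl fun i _ => by ring
      _ = _ := by rw [hv]; exact Finset.sum_congr rfl fun i _ => by ring
  generalize (1 / 2 * ∑ i, u i ^ 2 + 1 / 2 * ε ^ 2 * ∑ i, v i ^ 2 + Q) = E
  have hr : ∀ (j : Fin d) (z : ℝ), r * u j * (ε ^ 2 * z) = ε ^ 2 * (r * u j * z) :=
    fun j z => by ring
  simp only [mul_add, Finset.sum_add_distrib, Finset.sum_sub_distrib, mul_sub, hr,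
    ← Finset.mul_sum, ← Finset.sum_mul] at *
  linear_combination E * hmass + hu' + ε ^ 2 * hv' + ε ^ 2 * hcross - hu1 - ε ^ 2 * hv1
    + ε ^ 2 * hu2 - ε ^ 2 * hv2

theorem integral_eq_of_deriv_integral_eq_zero {d : ℕ} {T : ℝ} {e : ℝ × Vec d → ℝ}
    (he : ContDiff ℝ 1 e)
    (hzero : ∀ t ∈ Set.Icc 0 T, ∫ x in Box d, deriv (fun τ => e (τ, x)) t = 0) :
    ∀ t ∈ Set.Icc 0 T, ∫ x in Box d, e (t, x) = ∫ x in Box d, e (0, x) := by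
  have hder : ∀ t x, HasDerivAt (fun τ => e (τ, x)) (fderiv ℝ e (t, x) (1, 0)) t := by
    intro t x
    have h1 : HasFDerivAt e (fderiv ℝ e (t, x)) (t, x) :=
      (he.differentiable one_ne_zero (t, x)).hasFDerivAt
    exact h1.comp_hasDerivAt t ((hasDerivAt_id t).prodMk (hasDerivAt_const t x))
  have hcont : Continuous fun p : ℝ × Vec d => fderiv ℝ e p (1, 0) :=
    (he.continuous_fderiv one_ne_zero).clm_apply continuous_const
  have hbox : IsCompact (Box d) := isCompact_Icc
  have hmeas : MeasurableSet (Box d) := measurableSet_Icc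
  have hint : ∀ t, HasDerivAt (fun τ => ∫ x in Box d, e (τ, x))
      (∫ x in Box d, fderiv ℝ e (t, x) (1, 0)) t := by
    intro t
    obtain ⟨C, hC⟩ := ((isCompact_closedBall t 1).prod hbox).exists_bound_of_continuousOn
      hcont.continuousOn
    refine (hasDerivAt_integral_of_dominated_loc_of_deriv_le (bound := fun _ => C)
      (F := fun τ x => e (τ, x)) (F' := fun τ x => fderiv ℝ e (τ, x) (1, 0))
      (Metric.closedBall_mem_nhds t one_pos) ?_ ?_ ?_ ?_ ?_ ?_).2
    · exact Filter.Eventually.of_forall fun τ =>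
        (he.continuous.comp (by fun_prop)).aestronglyMeasurable
    · exact (he.continuous.comp (by fun_prop)).continuousOn.integrableOn_compact hbox
    · exact (hcont.comp (by fun_prop)).aestronglyMeasurable
    · filter_upwards [ae_restrict_mem hmeas] with x hx τ hτ
      exact hC (τ, x) ⟨hτ, hx⟩
    · exact continuousOn_const.integrableOn_compact hbox
    · exact Filter.Eventually.of_forall fun x τ _ => hder τ x
  have hz : ∀ t ∈ Set.Icc 0 T, ∫ x in Box d, fderiv ℝ e (t, x) (1, 0) = 0 := by
    intro t ht
    rw [← hzero t ht]
    exact integral_congr_ae (Filter.Eventually.of_forall fun x => (hder t x).deriv.symm)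
  refine constant_of_has_deriv_right_zero (fun t _ => (hint t).continuousAt.continuousWithinAt)
    fun t ht => ?_
  have := (hint t).hasDerivWithinAt (s := Set.Ici t)
  rwa [hz t ⟨ht.1, ht.2.le⟩] at this

theorem integral_divergence_eq_zero {d : ℕ} (hd : 1 ≤ d) {F : Fin d → Vec d → ℝ}
    (hF : ∀ j, ContDiff ℝ 1 (F j))
    (hper : ∀ j, Function.Periodic (F j) (Pi.single j 1)) :
    ∫ x in Box d, ∑ j, pd j (F j) x = 0 := by
  obtain ⟨n, rfl⟩ : ∃ n, d = n + 1 := ⟨d - 1, by omega⟩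
  unfold pd Box
  rw [integral_divergence_of_hasFDerivAt_off_countable' (0 : Vec (n + 1)) 1 zero_le_one F
    (fun j => fderiv ℝ (F j)) ∅ Set.countable_empty (fun j => (hF j).continuous.continuousOn)
    (fun x _ j => ((hF j).differentiable one_ne_zero x).hasFDerivAt)]
  · refine Finset.sum_eq_zero fun j _ => sub_eq_zero.2 ?_
    refine integral_congr_ae (Filter.Eventually.of_forall fun x => ?_)
    have hins : j.insertNth (1 : ℝ) x = j.insertNth (0 : ℝ) x + (Pi.single j 1 : Vec (n + 1)) := by
      ext k
      refine Fin.succAboveCases j ?_ (fun k => ?_) k <;> simp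
    simp only [Pi.one_apply, Pi.zero_apply]
    rw [hins]
    exact hper j _
  · refine Continuous.integrableOn_Icc (continuous_finsetSum _ fun j _ => ?_)
    exact ((hF j).continuous_fderiv one_ne_zero).clm_apply continuous_const

theorem pd_mul {d : ℕ} {i : Fin d} {f g : Vec d → ℝ} (hf : Differentiable ℝ f)
    (hg : Differentiable ℝ g) (x : Vec d) :
    pd i (fun y => f y * g y) x = pd i f x * g x + f x * pd i g x := by
  unfold pd
  rw [fderiv_fun_mul (hf x) (hg x)]
  simp
  ring

theorem hasDerivAt_pd {d : ℕ} (i : Fin d) {f : Vec d → ℝ} (hf : Differentiable ℝ f)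
    (x : Vec d) : HasDerivAt (fun τ : ℝ => f (x + τ • Pi.single i 1)) (pd i f x) 0 := by
  have h : HasFDerivAt f (fderiv ℝ f x) (x + (0 : ℝ) • Pi.single i 1) := by
    simpa using (hf x).hasFDerivAt
  have h2 : HasDerivAt (fun τ : ℝ => x + τ • (Pi.single i 1 : Vec d)) (Pi.single i 1) 0 := by
    simpa using ((hasDerivAt_id (0 : ℝ)).smul_const (Pi.single i 1 : Vec d)).const_add x
  exact h.comp_hasDerivAt 0 h2

theorem contDiff_pd {d : ℕ} (i : Fin d) {f : Vec d → ℝ} (hf : ContDiff ℝ (⊤ : ℕ∞) f) :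
    ContDiff ℝ (⊤ : ℕ∞) (pd i f) :=
  (hf.fderiv_right (m := (⊤ : ℕ∞)) (by norm_cast)).clm_apply contDiff_const

theorem periodic_pd {d : ℕ} (i : Fin d) {f : Vec d → ℝ} {a : Vec d}
    (hf : Function.Periodic f a) : Function.Periodic (pd i f) a := by
  intro x
  unfold pd
  rw [← fderiv_comp_add_right]
  simp only [hf _]

theorem pd_comm {d : ℕ} (i j : Fin d) {f : Vec d → ℝ} (hf : ContDiff ℝ (⊤ : ℕ∞) f)
    (x : Vec d) : pd i (pd j f) x = pd j (pd i f) x := by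
  have key : ∀ k l : Fin d, pd k (pd l f) x
      = fderiv ℝ (fderiv ℝ f) x (Pi.single k 1) (Pi.single l 1) := by
    intro k l
    have hd : DifferentiableAt ℝ (fderiv ℝ f) x :=
      (hf.fderiv_right (m := (⊤ : ℕ∞)) (by norm_cast)).differentiable (by simp) x
    change fderiv ℝ (fun y => fderiv ℝ f y (Pi.single l 1)) x (Pi.single k 1) = _
    rw [fderiv_clm_apply hd (differentiableAt_const _)]
    simp
  rw [key, key]
  exact hf.contDiffAt.isSymmSndFDerivAt
    (by rw [minSmoothness_of_isRCLikeNormedField]; norm_cast) _ _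

theorem pd_rpow {d : ℕ} (i : Fin d) {f : Vec d → ℝ} (hf : Differentiable ℝ f)
    (hpos : ∀ x, 0 < f x) (a : ℝ) (x : Vec d) :
    pd i (fun y => f y ^ a) x = a * f x ^ (a - 1) * pd i f x := by
  have h := (hf x).hasFDerivAt.rpow_const (p := a) (Or.inl (hpos x).ne')
  unfold pd
  rw [h.fderiv]
  simp

theorem pd_const_mul {d : ℕ} (i : Fin d) (c : ℝ) {f : Vec d → ℝ} (hf : Differentiable ℝ f)
    (x : Vec d) : pd i (fun y => c * f y) x = c * pd i f x := by
  unfold pd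
  rw [fderiv_const_mul (hf x)]
  simp

theorem SpacePeriodic.periodic_single {d : ℕ} {α : Type*} {f : ℝ → Vec d → α}
    (hf : SpacePeriodic f) (t : ℝ) (j : Fin d) : Function.Periodic (f t) (Pi.single j 1) := by
  intro x
  rw [← hf t x (Pi.single j 1)]
  congr 1
  ext i
  by_cases h : i = j
  · subst h; simp
  · simp [h]

/-- `v = ∇(f ^ a) / f` is curl free, being a function of `f` times `∇f`. -/
theorem pd_drift_comm {d : ℕ} {f : Vec d → ℝ} {V : Fin d → Vec d → ℝ} {a : ℝ}
    (hf : ContDiff ℝ (⊤ : ℕ∞) f) (hpos : ∀ x, 0 < f x)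
    (hVs : ∀ i, ContDiff ℝ (⊤ : ℕ∞) (V i))
    (hV : ∀ i x, V i x = pd i (fun y => f y ^ a) x / f x) (i j : Fin d) (x : Vec d) :
    pd i (V j) x = pd j (V i) x := by
  have hfd : Differentiable ℝ f := hf.differentiable (by simp)
  have hpow : ContDiff ℝ (⊤ : ℕ∞) (fun y => f y ^ a) :=
    hf.rpow_const_of_ne fun y => (hpos y).ne'
  have hVf : ∀ k, (fun y => V k y * f y) = pd k (fun y => f y ^ a) := fun k => funext fun y => by
    rw [hV, div_mul_cancel₀ _ (hpos y).ne']
  have hmul : ∀ k l, pd k (V l) x * f x + V l x * pd k f x = pd k (pd l (fun y => f y ^ a)) x :=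
    fun k l => by rw [← pd_mul ((hVs l).differentiable (by simp)) hfd, hVf]
  have hcross : V j x * pd i f x = V i x * pd j f x := by
    rw [hV, hV, pd_rpow _ hfd hpos, pd_rpow _ hfd hpos]
    ring
  have h := hmul i j
  rw [pd_comm i j hpow, ← hmul j i, hcross] at h
  exact mul_right_cancel₀ (hpos x).ne' (add_right_cancel h)

theorem integral_energy_rate_eq_zero {d : ℕ} (hd : 1 ≤ d) {ε : ℝ} {R M L Q Rt : Vec d → ℝ}
    {U V Ut Vt : Fin d → Vec d → ℝ}
    (hR : ContDiff ℝ (⊤ : ℕ∞) R) (hM : ContDiff ℝ (⊤ : ℕ∞) M) (hL : ContDiff ℝ (⊤ : ℕ∞) L)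
    (hQ : ContDiff ℝ (⊤ : ℕ∞) Q)
    (hU : ∀ i, ContDiff ℝ (⊤ : ℕ∞) (U i)) (hV : ∀ i, ContDiff ℝ (⊤ : ℕ∞) (V i))
    (hRper : ∀ j, Function.Periodic R (Pi.single j 1))
    (hMper : ∀ j, Function.Periodic M (Pi.single j 1))
    (hLper : ∀ j, Function.Periodic L (Pi.single j 1))
    (hQper : ∀ j, Function.Periodic Q (Pi.single j 1))
    (hUper : ∀ i j, Function.Periodic (U i) (Pi.single j 1))
    (hVper : ∀ i j, Function.Periodic (V i) (Pi.single j 1))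
    (hsymm : ∀ i j x, pd i (V j) x = pd j (V i) x)
    (hmass : ∀ x, Rt x + ∑ j, pd j (fun y => R y * U j y) x = 0)
    (hmom : ∀ x i, Rt x * U i x + R x * Ut i x
        + ∑ j, pd j (fun y => R y * U i y * U j y) x + R x * pd i Q x
      = ε ^ 2 * (∑ j, pd j (fun y => M y * pd j (V i) y) x
          + 1 / 2 * pd i (fun y => L y * ∑ k, pd k (V k) y) x))
    (hdrift : ∀ x i, Rt x * V i x + R x * Vt i x
        + ∑ j, pd j (fun y => R y * V i y * U j y) x
        + ∑ j, pd j (fun y => M y * pd i (U j) y) x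
        + 1 / 2 * pd i (fun y => L y * ∑ k, pd k (U k) y) x = 0) :
    ∫ x in Box d,
      (Rt x * (1 / 2 * ∑ i, U i x ^ 2 + 1 / 2 * ε ^ 2 * ∑ i, V i x ^ 2 + Q x)
        + R x * (∑ i, U i x * Ut i x + ε ^ 2 * ∑ i, V i x * Vt i x)) = 0 := by
  have hDU : ∀ i j, ContDiff ℝ (⊤ : ℕ∞) (pd i (U j)) := fun i j => contDiff_pd i (hU j)
  have hDV : ∀ i j, ContDiff ℝ (⊤ : ℕ∞) (pd i (V j)) := fun i j => contDiff_pd i (hV j)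
  let F : Fin d → Vec d → ℝ := fun j y =>
    R y * U j y * (1 / 2 * ∑ i, U i y ^ 2 + 1 / 2 * ε ^ 2 * ∑ i, V i y ^ 2 + Q y)
      + ε ^ 2 * (∑ i, V i y * (M y * pd i (U j) y) - ∑ i, U i y * (M y * pd j (V i) y)
        + 1 / 2 * (V j y * (L y * ∑ k, pd k (U k) y))
        - 1 / 2 * (U j y * (L y * ∑ k, pd k (V k) y)))
  have hF : ∀ j, ContDiff ℝ (⊤ : ℕ∞) (F j) := fun j => by fun_prop
  have hFper : ∀ j, Function.Periodic (F j) (Pi.single j 1) := by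
    intro j y
    simp only [F, hRper j y, hMper j y, hLper j y, hQper j y, hUper _ j y, hVper _ j y,
      periodic_pd _ (hUper _ j) y, periodic_pd _ (hVper _ j) y]
  have hpdF : ∀ j x, pd j (F j) x =
      pd j (fun y => R y * U j y) x
          * (1 / 2 * ∑ i, U i x ^ 2 + 1 / 2 * ε ^ 2 * ∑ i, V i x ^ 2 + Q x)
        + R x * U j x * (∑ i, U i x * pd j (U i) x + ε ^ 2 * ∑ i, V i x * pd j (V i) x
          + pd j Q x)
        + ε ^ 2 * (∑ i, (pd j (V i) x * (M x * pd i (U j) x)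
              + V i x * pd j (fun y => M y * pd i (U j) y) x)
          - ∑ i, (pd j (U i) x * (M x * pd j (V i) x)
              + U i x * pd j (fun y => M y * pd j (V i) y) x)
          + 1 / 2 * (pd j (V j) x * (L x * ∑ k, pd k (U k) x)
              + V j x * pd j (fun y => L y * ∑ k, pd k (U k) y) x)
          - 1 / 2 * (pd j (U j) x * (L x * ∑ k, pd k (V k) x)
              + U j x * pd j (fun y => L y * ∑ k, pd k (V k) y) x)) := by
    intro j x
    have D : ∀ {f : Vec d → ℝ}, ContDiff ℝ (⊤ : ℕ∞) f →
        HasDerivAt (fun τ : ℝ => f (x + τ • Pi.single j 1)) (pd j f x) 0 :=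
      fun hf => hasDerivAt_pd j (hf.differentiable (by simp)) x
    have hRU : ContDiff ℝ (⊤ : ℕ∞) (fun y => R y * U j y) := hR.mul (hU j)
    have hMU : ∀ i, ContDiff ℝ (⊤ : ℕ∞) (fun y => M y * pd i (U j) y) :=
      fun i => hM.mul (hDU i j)
    have hMV : ∀ i, ContDiff ℝ (⊤ : ℕ∞) (fun y => M y * pd j (V i) y) :=
      fun i => hM.mul (hDV j i)
    have hLU : ContDiff ℝ (⊤ : ℕ∞) (fun y => L y * ∑ k, pd k (U k) y) := by fun_prop
    have hLV : ContDiff ℝ (⊤ : ℕ∞) (fun y => L y * ∑ k, pd k (V k) y) := by fun_prop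
    have h := ((D hRU).fun_mul (((HasDerivAt.fun_sum (u := Finset.univ)
        fun i _ => (D (hU i)).fun_pow 2).const_mul (1 / 2)).fun_add
          ((HasDerivAt.fun_sum (u := Finset.univ)
            fun i _ => (D (hV i)).fun_pow 2).const_mul (1 / 2 * ε ^ 2)) |>.fun_add (D hQ))).fun_add
      (((((HasDerivAt.fun_sum (u := Finset.univ) fun i _ => (D (hV i)).fun_mul (D (hMU i))).fun_sub
        (HasDerivAt.fun_sum (u := Finset.univ) fun i _ => (D (hU i)).fun_mul (D (hMV i)))).fun_add
        (((D (hV j)).fun_mul (D hLU)).const_mul (1 / 2))).fun_sub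
        (((D (hU j)).fun_mul (D hLV)).const_mul (1 / 2))).const_mul (ε ^ 2))
    have hsq : ∀ w z : Fin d → ℝ, ∑ i, 2 * w i * z i = 2 * ∑ i, w i * z i := fun w z => by
      rw [Finset.mul_sum]
      exact Finset.sum_congr rfl fun i _ => by ring
    rw [(D (hF j)).unique h]
    simp only [zero_smul, add_zero, Nat.cast_ofNat, Nat.add_one_sub_one, pow_one, hsq]
    ring
  have hRd : ∀ j, Differentiable ℝ (fun y => R y * U j y) := fun j =>
    (hR.mul (hU j)).differentiable (by simp)
  have htransport : ∀ (W : Fin d → Vec d → ℝ), (∀ i, ContDiff ℝ (⊤ : ℕ∞) (W i)) → ∀ i j x,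
      pd j (fun y => R y * W i y * U j y) x
        = pd j (fun y => R y * U j y) x * W i x + R x * U j x * pd j (W i) x := by
    intro W hW i j x
    rw [← pd_mul (hRd j) ((hW i).differentiable (by simp))]
    exact congrArg (fun f => pd j f x) (funext fun y => by ring)
  rw [← neg_eq_zero, ← integral_neg,
    ← integral_divergence_eq_zero hd (fun j => (hF j).of_le (by norm_cast)) hFper]
  refine integral_congr_ae (Filter.Eventually.of_forall fun x => ?_)
  simp only [hpdF]
  refine neg_eq_iff_add_eq_zero.2 (energy_flux_algebra (fun i j => hsymm i j x) (hmass x) ?_ ?_)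
  · intro i
    simpa only [htransport U hU] using hmom x i
  · intro i
    simpa only [htransport V hV] using hdrift x i

/-- Conservation of the energy `E(t) = ∫ (½ρ|u|² + ½ε²K(ρ)|∇ρ|² + H(ρ))` for smooth
solutions of the augmented Euler–Korteweg system on the torus, with
`μ(ρ) = ρ^((s+3)/2)`, `λ(ρ) = 2(ρμ'(ρ) − μ(ρ))`, `K(ρ) = ((s+3)²/4)ρ^s`,
`p(ρ) = ρ^γ`, `H(ρ) = ρ^γ/(γ−1)` and the drift velocity `v = ∇(μ∘ρ)/ρ`. -/
theorem euler_korteweg_energy_conservation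
    (d : ℕ) (hd1 : 1 ≤ d) (hd3 : d ≤ 3)
    (T ε γ s : ℝ) (hT : 0 < T) (hε : 0 < ε) (hγ : 1 < γ) (hs : -1 ≤ s)
    (ρ : ℝ → Vec d → ℝ) (u v : ℝ → Vec d → Vec d)
    (hρs : ContDiff ℝ (⊤ : ℕ∞) (fun p : ℝ × Vec d => ρ p.1 p.2))
    (hus : ContDiff ℝ (⊤ : ℕ∞) (fun p : ℝ × Vec d => u p.1 p.2))
    (hvs : ContDiff ℝ (⊤ : ℕ∞) (fun p : ℝ × Vec d => v p.1 p.2))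
    (hρper : SpacePeriodic ρ) (huper : SpacePeriodic u) (hvper : SpacePeriodic v)
    (hρpos : ∀ t ∈ Set.Icc 0 T, ∀ x, 0 < ρ t x)
    (μ lam : ℝ → ℝ)
    (hμ : ∀ z : ℝ, μ z = z ^ ((s + 3) / 2))
    (hlam : ∀ z : ℝ, lam z = 2 * (z * (((s + 3) / 2) * z ^ ((s + 1) / 2)) - μ z))
    -- definition of the drift velocity `v = ∇(μ∘ρ)/ρ`
    (hv : ∀ t ∈ Set.Icc 0 T, ∀ x i, v t x i = pd i (fun y => μ (ρ t y)) x / ρ t x)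
    -- mass equation `∂ₜρ + div(ρu) = 0`
    (hmass : ∀ t ∈ Set.Icc 0 T, ∀ x,
      deriv (fun τ => ρ τ x) t + (∑ i, pd i (fun y => ρ t y * u t y i) x) = 0)
    -- momentum equation
    -- `∂ₜ(ρu) + div(ρu⊗u) + ∇p(ρ) = ε²[div(μ(ρ)∇v) + ½∇(λ(ρ) div v)]`
    (hmom : ∀ t ∈ Set.Icc 0 T, ∀ x, ∀ i,
      deriv (fun τ => ρ τ x * u τ x i) t
          + (∑ j, pd j (fun y => ρ t y * u t y i * u t y j) x)
          + pd i (fun y => ρ t y ^ γ) x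
        = ε ^ 2 * ((∑ j, pd j (fun y => μ (ρ t y) * pd j (fun z => v t z i) y) x)
            + (1 / 2) * pd i (fun y =>
                lam (ρ t y) * ∑ j, pd j (fun z => v t z j) y) x))
    -- drift equation `∂ₜ(ρv) + div(ρv⊗u) + div(μ(ρ)ᵗ∇u) + ½∇(λ(ρ) div u) = 0`
    (hdrift : ∀ t ∈ Set.Icc 0 T, ∀ x, ∀ i,
      deriv (fun τ => ρ τ x * v τ x i) t
          + (∑ j, pd j (fun y => ρ t y * v t y i * u t y j) x)
          + (∑ j, pd j (fun y => μ (ρ t y) * pd i (fun z => u t z j) y) x)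
          + (1 / 2) * pd i (fun y =>
              lam (ρ t y) * ∑ j, pd j (fun z => u t z j) y) x = 0) :
    ∀ t ∈ Set.Icc 0 T,
      (∫ x in Box d,
          ((1 / 2) * ρ t x * (∑ i, (u t x i) ^ 2)
            + (1 / 2) * ε ^ 2 * (((s + 3) ^ 2 / 4) * ρ t x ^ s)
                * (∑ i, (pd i (fun y => ρ t y) x) ^ 2)
            + ρ t x ^ γ / (γ - 1)))
        = ∫ x in Box d,
            ((1 / 2) * ρ 0 x * (∑ i, (u 0 x i) ^ 2)
              + (1 / 2) * ε ^ 2 * (((s + 3) ^ 2 / 4) * ρ 0 x ^ s)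
                  * (∑ i, (pd i (fun y => ρ 0 y) x) ^ 2)
              + ρ 0 x ^ γ / (γ - 1)) := by
  have hρx : ∀ t, ContDiff ℝ (⊤ : ℕ∞) (ρ t) := fun t =>
    hρs.comp (contDiff_const.prodMk contDiff_id)
  have hux : ∀ t i, ContDiff ℝ (⊤ : ℕ∞) (fun y => u t y i) := fun t i =>
    (contDiff_apply ℝ ℝ i).comp (hus.comp (contDiff_const.prodMk contDiff_id))
  have hvx : ∀ t i, ContDiff ℝ (⊤ : ℕ∞) (fun y => v t y i) := fun t i =>
    (contDiff_apply ℝ ℝ i).comp (hvs.comp (contDiff_const.prodMk contDiff_id))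
  have hρt : ∀ t x, DifferentiableAt ℝ (fun τ => ρ τ x) t := fun t x =>
    (hρs.comp (contDiff_id.prodMk contDiff_const)).differentiable (by simp) t
  have hut : ∀ t x i, DifferentiableAt ℝ (fun τ => u τ x i) t := fun t x i =>
    ((contDiff_apply ℝ ℝ i).comp
      (hus.comp (contDiff_id.prodMk contDiff_const))).differentiable (by simp) t
  have hvt : ∀ t x i, DifferentiableAt ℝ (fun τ => v τ x i) t := fun t x i =>
    ((contDiff_apply ℝ ℝ i).comp
      (hvs.comp (contDiff_id.prodMk contDiff_const))).differentiable (by simp) t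
  have hμ' : μ = fun z => z ^ ((s + 3) / 2) := funext hμ
  have hlam' : lam = fun z => 2 * (z * (((s + 3) / 2) * z ^ ((s + 1) / 2)) - z ^ ((s + 3) / 2)) :=
    funext fun z => by rw [hlam, hμ]
  let e : ℝ × Vec d → ℝ := fun p => ρ p.1 p.2 * (1 / 2 * ∑ i, u p.1 p.2 i ^ 2
    + 1 / 2 * ε ^ 2 * ∑ i, v p.1 p.2 i ^ 2) + ρ p.1 p.2 ^ γ / (γ - 1)
  have he : ContDiff ℝ 1 e := by
    have h1 : ContDiff ℝ 1 (fun p : ℝ × Vec d => ρ p.1 p.2) := hρs.of_le (by norm_cast)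
    have h2 : ∀ i, ContDiff ℝ 1 (fun p : ℝ × Vec d => u p.1 p.2 i) := fun i =>
      (contDiff_apply ℝ ℝ i).comp (hus.of_le (by norm_cast))
    have h3 : ∀ i, ContDiff ℝ 1 (fun p : ℝ × Vec d => v p.1 p.2 i) := fun i =>
      (contDiff_apply ℝ ℝ i).comp (hvs.of_le (by norm_cast))
    have h4 : ContDiff ℝ 1 (fun p : ℝ × Vec d => ρ p.1 p.2 ^ γ) :=
      ContDiff.rpow_const_of_le (m := 1) h1 (by exact_mod_cast hγ.le)
    exact (h1.mul ((contDiff_const.mul (ContDiff.sum fun i _ => (h2 i).pow 2)).add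
      (contDiff_const.mul (ContDiff.sum fun i _ => (h3 i).pow 2)))).add (h4.div_const _)
  have henergy : ∀ t ∈ Set.Icc 0 T,
      (∫ x in Box d,
          ((1 / 2) * ρ t x * (∑ i, (u t x i) ^ 2)
            + (1 / 2) * ε ^ 2 * (((s + 3) ^ 2 / 4) * ρ t x ^ s)
                * (∑ i, (pd i (fun y => ρ t y) x) ^ 2)
            + ρ t x ^ γ / (γ - 1))) = ∫ x in Box d, e (t, x) := by
    intro t ht
    refine integral_congr_ae (Filter.Eventually.of_forall fun x => ?_)
    have hpos := hρpos t ht x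
    have hK : ((s + 3) ^ 2 / 4) * ρ t x ^ s * (∑ i, (pd i (fun y => ρ t y) x) ^ 2)
        = ρ t x * ∑ i, v t x i ^ 2 := by
      rw [Finset.mul_sum, Finset.mul_sum]
      refine Finset.sum_congr rfl fun i _ => ?_
      have hpow : (ρ t x ^ ((s + 3) / 2 - 1)) ^ 2 = ρ t x ^ s * ρ t x := by
        rw [← Real.rpow_natCast, ← Real.rpow_mul hpos.le, ← Real.rpow_add_one hpos.ne']
        congr 1
        push_cast
        ring
      rw [hv t ht, hμ', pd_rpow _ ((hρx t).differentiable (by simp)) (hρpos t ht), div_pow,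
        mul_pow, mul_pow, hpow]
      field_simp
      ring
    simp only [e]
    linear_combination 1 / 2 * ε ^ 2 * hK
  intro t ht
  rw [henergy t ht, henergy 0 (Set.left_mem_Icc.2 hT.le)]
  refine integral_eq_of_deriv_integral_eq_zero he ?_ t ht
  clear t ht
  intro t ht
  have hpos := hρpos t ht
  have hρd : Differentiable ℝ (ρ t) := (hρx t).differentiable (by simp)
  have hpow : ∀ a : ℝ, ContDiff ℝ (⊤ : ℕ∞) (fun y => ρ t y ^ a) := fun a =>
    (hρx t).rpow_const_of_ne fun y => (hpos y).ne'
  have hγ1 : γ - 1 ≠ 0 := by linarith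
  have hPer : ∀ j x, ρ t (x + Pi.single j 1) = ρ t x := fun j => hρper.periodic_single t j
  rw [← integral_energy_rate_eq_zero hd1 (ε := ε) (R := ρ t) (M := fun y => μ (ρ t y))
    (L := fun y => lam (ρ t y)) (Q := fun y => γ / (γ - 1) * ρ t y ^ (γ - 1))
    (Rt := fun x => deriv (fun τ => ρ τ x) t)
    (U := fun i y => u t y i) (V := fun i y => v t y i)
    (Ut := fun i x => deriv (fun τ => u τ x i) t) (Vt := fun i x => deriv (fun τ => v τ x i) t)
    (hρx t) (by rw [hμ']; exact hpow _)
    (by rw [hlam']; exact contDiff_const.mul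
          (((hρx t).mul (contDiff_const.mul (hpow _))).sub (hpow _)))
    (contDiff_const.mul (hpow _)) (hux t) (hvx t)
    hPer (fun j x => by simp only [hPer]) (fun j x => by simp only [hPer])
    (fun j x => by simp only [hPer])
    (fun i j x => congrFun (huper.periodic_single t j x) i)
    (fun i j x => congrFun (hvper.periodic_single t j x) i)
    (pd_drift_comm (hρx t) hpos (hvx t) (a := (s + 3) / 2)
      (fun i x => by rw [hv t ht, hμ']))
    (hmass t ht) ?_ ?_]
  · refine integral_congr_ae (Filter.Eventually.of_forall fun x => ?_)
    have h1 := (hρt t x).hasDerivAt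
    have h := (h1.fun_mul
      (((HasDerivAt.fun_sum (u := Finset.univ)
        fun i _ => (hut t x i).hasDerivAt.fun_pow 2).const_mul (1 / 2)).fun_add
      ((HasDerivAt.fun_sum (u := Finset.univ)
        fun i _ => (hvt t x i).hasDerivAt.fun_pow 2).const_mul (1 / 2 * ε ^ 2)))).fun_add
      ((h1.rpow_const (p := γ) (Or.inl (hpos x).ne')).div_const (γ - 1))
    have hsq : ∀ w z : Fin d → ℝ, ∑ i, 2 * w i * z i = 2 * ∑ i, w i * z i := fun w z => by
      rw [Finset.mul_sum]
      exact Finset.sum_congr rfl fun i _ => by ring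
    refine h.deriv.trans ?_
    simp only [Nat.cast_ofNat, Nat.add_one_sub_one, pow_one, hsq]
    ring
  · intro x i
    have h := hmom t ht x i
    rw [deriv_fun_mul (hρt t x) (hut t x i), pd_rpow i hρd hpos] at h
    rw [← h, pd_const_mul i _ ((hpow _).differentiable (by simp)), pd_rpow i hρd hpos,
      Real.rpow_sub_one (hpos x).ne' (γ - 1)]
    have := (hpos x).ne'
    field_simp
  · intro x i
    have h := hdrift t ht x i
    rwa [deriv_fun_mul (hρt t x) (hvt t x i)] at h
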